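/- Let M be an equivelar map of Schläfli type {p,q} and let v be a vertex of M. Let n be the number of Γ(M)-orbits on flags that contain at least one flag belonging to v. Then n divides 2q; moreover, if some flag Φ belonging to v satisfies σ1Φ ∈ Γ(M)·Φ or σ2Φ ∈ Γ(M)·Φ, then n divides q. -/

import Mathlib

/-- A map: a finite nonempty set of flags with three fixed-point-free involutions
`s0, s1, s2` such that `s0 * s2` is also a fixed-point-free involution and the
group generated by them acts transitively on the flags. -/
structure CMap (F : Type) [Fintype F] where
  nonempty : Nonempty F
  s0 : Equiv.Perm F
  s1 : Equiv.Perm F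
  s2 : Equiv.Perm F
  invol0 : s0 * s0 = 1
  invol1 : s1 * s1 = 1
  invol2 : s2 * s2 = 1
  fpf0 : ∀ x, s0 x ≠ x
  fpf1 : ∀ x, s1 x ≠ x
  fpf2 : ∀ x, s2 x ≠ x
  invol02 : (s0 * s2) * (s0 * s2) = 1
  fpf02 : ∀ x, s0 (s2 x) ≠ x
  conn : ∀ x y : F, ∃ g ∈ Subgroup.closure ({s0, s1, s2} : Set (Equiv.Perm F)), g x = y

namespace CMap

variable {F : Type} [Fintype F]

/-- The automorphism group of a map: all permutations of the flags commuting
with each of `s0, s1, s2`. -/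
def aut (M : CMap F) : Subgroup (Equiv.Perm F) :=
  Subgroup.centralizer {M.s0, M.s1, M.s2}

/-- The vertex containing a flag `x`: the orbit of `x` under `⟨s1, s2⟩`. -/
def vertexOf (M : CMap F) (x : F) : Set F :=
  MulAction.orbit (Subgroup.closure ({M.s1, M.s2} : Set (Equiv.Perm F))) x

/-- The edge containing a flag `x`: the orbit of `x` under `⟨s0, s2⟩`. -/
def edgeOf (M : CMap F) (x : F) : Set F :=
  MulAction.orbit (Subgroup.closure ({M.s0, M.s2} : Set (Equiv.Perm F))) x

/-- The face containing a flag `x`: the orbit of `x` under `⟨s0, s1⟩`. -/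
def faceOf (M : CMap F) (x : F) : Set F :=
  MulAction.orbit (Subgroup.closure ({M.s0, M.s1} : Set (Equiv.Perm F))) x

/-- The orbit of a flag under the automorphism group. -/
def flagOrbit (M : CMap F) (x : F) : Set F :=
  MulAction.orbit M.aut x

noncomputable def numVertices (M : CMap F) : ℕ := Nat.card (Set.range M.vertexOf)

noncomputable def numEdges (M : CMap F) : ℕ := Nat.card (Set.range M.edgeOf)

noncomputable def numFaces (M : CMap F) : ℕ := Nat.card (Set.range M.faceOf)

/-- The Euler characteristic `V - E + F` of a map. -/
noncomputable def euler (M : CMap F) : ℤ :=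
  (M.numVertices : ℤ) - (M.numEdges : ℤ) + (M.numFaces : ℤ)

/-- The number of orbits of the automorphism group on flags. -/
noncomputable def numFlagOrbits (M : CMap F) : ℕ := Nat.card (Set.range M.flagOrbit)

/-- `M` is a `k`-orbit map if its automorphism group has exactly `k` orbits on flags. -/
def IsKOrbit (M : CMap F) (k : ℕ) : Prop := M.numFlagOrbits = k

/-- A map is regular if it is a 1-orbit map. -/
def IsRegular (M : CMap F) : Prop := M.IsKOrbit 1

/-- A map is chiral if it is a 2-orbit map in which every flag lies in a
different automorphism orbit from each of its images under `s0, s1, s2`. -/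
def IsChiral (M : CMap F) : Prop :=
  M.IsKOrbit 2 ∧ ∀ x : F,
    M.s0 x ∉ M.flagOrbit x ∧ M.s1 x ∉ M.flagOrbit x ∧ M.s2 x ∉ M.flagOrbit x

/-- A map is vertex-transitive if its automorphism group acts transitively on vertices. -/
def VertexTransitive (M : CMap F) : Prop :=
  ∀ x y : F, ∃ g ∈ M.aut, M.vertexOf (g x) = M.vertexOf y

/-- A map is edge-transitive if its automorphism group acts transitively on edges. -/
def EdgeTransitive (M : CMap F) : Prop :=
  ∀ x y : F, ∃ g ∈ M.aut, M.edgeOf (g x) = M.edgeOf y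

/-- `M` is equivelar of Schläfli type `{p, q}`: every face has exactly `2p` flags
and every vertex has exactly `2q` flags. -/
def Equivelar (M : CMap F) (p q : ℕ) : Prop :=
  (∀ x : F, Nat.card (M.faceOf x) = 2 * p) ∧
  (∀ x : F, Nat.card (M.vertexOf x) = 2 * q)

/-- A map is orientable if the flags can be partitioned into two classes so that
each of `s0, s1, s2` maps each class into the other. -/
def Orientable (M : CMap F) : Prop :=
  ∃ A : Set F,
    (∀ x, M.s0 x ∈ A ↔ x ∉ A) ∧ (∀ x, M.s1 x ∈ A ↔ x ∉ A) ∧ (∀ x, M.s2 x ∈ A ↔ x ∉ A)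

end CMap

/-- Two maps are isomorphic if there is a bijection between their flag sets
commuting with the respective involutions. -/
def CMap.Isomorphic {F F' : Type} [Fintype F] [Fintype F'] (M : CMap F) (N : CMap F') : Prop :=
  ∃ e : F ≃ F',
    (∀ x, e (M.s0 x) = N.s0 (e x)) ∧ (∀ x, e (M.s1 x) = N.s1 (e x)) ∧
    (∀ x, e (M.s2 x) = N.s2 (e x))

open scoped Pointwise

namespace CMap

variable {F : Type} [Fintype F] (M : CMap F)

theorem apply_comm_of_mem_closure {M : CMap F} {g h : Equiv.Perm F} (hg : g ∈ M.aut)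
    (hh : h ∈ Subgroup.closure ({M.s0, M.s1, M.s2} : Set (Equiv.Perm F))) (x : F) :
    h (g x) = g (h x) := by
  have hle : Subgroup.closure ({M.s0, M.s1, M.s2} : Set (Equiv.Perm F)) ≤
      Subgroup.centralizer {g} := by
    rw [Subgroup.closure_le]
    intro s hs
    exact Subgroup.mem_centralizer_singleton_iff.2
      (Subgroup.mem_centralizer_iff.1 hg s hs)
  exact congrArg (fun k : Equiv.Perm F => k x)
    (Subgroup.mem_centralizer_singleton_iff.1 (hle hh))

/-- The automorphism group acts semiregularly on flags. -/
theorem aut_ext {M : CMap F} {g h : Equiv.Perm F} (hg : g ∈ M.aut) (hh : h ∈ M.aut) {x : F}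
    (hx : g x = h x) : g = h := by
  ext y
  obtain ⟨k, hk, rfl⟩ := M.conn x y
  rw [← apply_comm_of_mem_closure hg hk, hx, apply_comm_of_mem_closure hh hk]

theorem smul_vertexOf {M : CMap F} {g : Equiv.Perm F} (hg : g ∈ M.aut) (x : F) :
    g • M.vertexOf x = M.vertexOf (g x) := by
  have hle : Subgroup.closure ({M.s1, M.s2} : Set (Equiv.Perm F)) ≤
      Subgroup.closure {M.s0, M.s1, M.s2} := Subgroup.closure_mono (Set.subset_insert _ _)
  unfold vertexOf MulAction.orbit
  rw [← Set.image_smul, ← Set.range_comp]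
  congr 1
  ext ⟨h, hh⟩
  exact (apply_comm_of_mem_closure hg (hle hh) x).symm

theorem vertexOf_eq_of_mem {M : CMap F} {x y : F} (h : y ∈ M.vertexOf x) :
    M.vertexOf y = M.vertexOf x :=
  MulAction.orbit_eq_iff.2 h

theorem flagOrbit_eq_iff {M : CMap F} {x y : F} :
    M.flagOrbit y = M.flagOrbit x ↔ ∃ g ∈ M.aut, g x = y :=
  MulAction.orbit_eq_iff.trans
    ⟨fun ⟨g, hg⟩ => ⟨g, g.2, hg⟩, fun ⟨g, hg, h⟩ => ⟨⟨g, hg⟩, h⟩⟩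

/-- The group of automorphisms preserving the vertex of a flag. -/
def vertexStabilizer (x : F) : Subgroup (Equiv.Perm F) :=
  M.aut ⊓ MulAction.stabilizer (Equiv.Perm F) (M.vertexOf x)

theorem mem_vertexStabilizer_iff {M : CMap F} {g : Equiv.Perm F} {x y : F} (hg : g ∈ M.aut)
    (hy : y ∈ M.vertexOf x) : g ∈ M.vertexStabilizer x ↔ g y ∈ M.vertexOf x := by
  rw [vertexStabilizer, Subgroup.mem_inf, MulAction.mem_stabilizer_iff,
    ← vertexOf_eq_of_mem hy, smul_vertexOf hg]
  exact ⟨fun h => h.2 ▸ MulAction.mem_orbit_self _, fun h => ⟨hg, vertexOf_eq_of_mem h⟩⟩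

/-- Every automorphism orbit meeting a vertex does so in as many flags as there are
automorphisms preserving the vertex. -/
theorem card_vertexOf (x : F) :
    Nat.card (M.vertexOf x) =
      Nat.card (M.flagOrbit '' M.vertexOf x) * Nat.card (M.vertexStabilizer x) := by
  classical
  have hfiber : ∀ y ∈ M.vertexOf x,
      Nat.card {z // z ∈ M.vertexOf x ∧ M.flagOrbit z = M.flagOrbit y} =
        Nat.card (M.vertexStabilizer x) := by
    intro y hy
    refine (Nat.card_congr (Equiv.ofBijective
      (fun g : M.vertexStabilizer x => ⟨g.1 y,
        (mem_vertexStabilizer_iff g.2.1 hy).1 g.2,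
        flagOrbit_eq_iff.2 ⟨g.1, g.2.1, rfl⟩⟩) ⟨?_, ?_⟩)).symm
    · intro g h hgh
      exact Subtype.ext (aut_ext g.2.1 h.2.1 (congrArg Subtype.val hgh))
    · rintro ⟨z, hz, hzy⟩
      obtain ⟨g, hg, rfl⟩ := flagOrbit_eq_iff.1 hzy
      exact ⟨⟨g, (mem_vertexStabilizer_iff hg hy).2 hz⟩, rfl⟩
  have hsum := Finset.card_eq_sum_card_image M.flagOrbit (M.vertexOf x).toFinset
  rw [Finset.sum_const_nat (m := Nat.card (M.vertexStabilizer x))] at hsum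
  · rw [Nat.card_eq_card_toFinset, hsum, Nat.card_eq_card_toFinset, Set.toFinset_image]
  · intro o ho
    obtain ⟨y, hy, rfl⟩ := Finset.mem_image.1 ho
    rw [← hfiber y (Set.mem_toFinset.1 hy), Nat.subtype_card]
    simp

/-- An automorphism mapping a flag of a vertex to an adjacent flag of that vertex is an
involution preserving the vertex. -/
theorem two_dvd_card_vertexStabilizer {M : CMap F} {s : Equiv.Perm F}
    (hs : s ∈ ({M.s1, M.s2} : Set (Equiv.Perm F))) {x y : F} (hy : y ∈ M.vertexOf x)
    (hsy : s y ∈ M.flagOrbit y) : 2 ∣ Nat.card (M.vertexStabilizer x) := by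
  obtain ⟨⟨g, hg⟩, hgy⟩ := hsy
  replace hgy : g y = s y := hgy
  have hinv : s (s y) = y ∧ s y ≠ y := by
    rcases hs with rfl | rfl
    · exact ⟨congrArg (fun k : Equiv.Perm F => k y) M.invol1, M.fpf1 y⟩
    · exact ⟨congrArg (fun k : Equiv.Perm F => k y) M.invol2, M.fpf2 y⟩
  have hmem : s y ∈ M.vertexOf x := by
    rw [← vertexOf_eq_of_mem hy]
    exact ⟨⟨s, Subgroup.subset_closure hs⟩, rfl⟩
  have hgH : g ∈ M.vertexStabilizer x := (mem_vertexStabilizer_iff hg hy).2 (hgy ▸ hmem)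
  have hcomm : s (g y) = g (s y) :=
    apply_comm_of_mem_closure hg (Subgroup.subset_closure (Set.mem_insert_of_mem _ hs)) y
  have hsq : g ^ 2 = 1 := by
    refine aut_ext (pow_mem hg 2) (one_mem _) (x := y) ?_
    rw [pow_two, Equiv.Perm.mul_apply, hgy, ← hcomm, hgy, hinv.1, Equiv.Perm.one_apply]
  have hne : g ≠ 1 := by
    rintro rfl
    exact hinv.2 hgy.symm
  rw [← orderOf_eq_prime hsq hne]
  exact Subgroup.orderOf_dvd_natCard _ hgH

end CMap

/-- In an equivelar map of type `{p, q}`, the number `n` of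
automorphism orbits on flags meeting a given vertex `v` divides `2q`; if moreover
some flag `Φ` of `v` has `σ₁Φ` or `σ₂Φ` in the orbit of `Φ`, then `n` divides `q`. -/
theorem stmt_2 {F : Type} [Fintype F] (M : CMap F) (p q : ℕ)
    (heq : M.Equivelar p q) (x0 : F) (v : Set F) (hv : v = M.vertexOf x0)
    (n : ℕ) (hn : n = Nat.card (M.flagOrbit '' v)) :
    n ∣ 2 * q ∧
      ((∃ Φ ∈ v, M.s1 Φ ∈ M.flagOrbit Φ ∨ M.s2 Φ ∈ M.flagOrbit Φ) → n ∣ q) := by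
  subst hv hn
  have hcard := M.card_vertexOf x0
  rw [heq.2 x0] at hcard
  refine ⟨⟨_, hcard⟩, ?_⟩
  rintro ⟨Φ, hΦ, h⟩
  have h2 : 2 ∣ Nat.card (M.vertexStabilizer x0) := by
    rcases h with h | h
    · exact CMap.two_dvd_card_vertexStabilizer (by simp) hΦ h
    · exact CMap.two_dvd_card_vertexStabilizer (by simp) hΦ h
  obtain ⟨m, hm⟩ := h2
  rw [hm, mul_left_comm] at hcard
  exact ⟨m, Nat.eq_of_mul_eq_mul_left two_pos hcard⟩
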